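/- arXiv:1705.04291 — 2 statements merged into one kernel-verified Lean document; each statement's English description precedes it below -/
import Mathlib

section
/- Let the weights μ_1, ..., μ_n ≥ 0 be pairwise distinct with μ_{q+1} > μ_{q+2} > ... > μ_n, and let X be an optimal symmetric solution of ROCP. If x_{i,k−1} > 0 and x_{jk} > 0 for some pendent indices i, j ∈ {q+1, ..., n} and some position k ≤ ⌈q/2⌉, then i ≤ j. -/
open Matrix Finset

/-- The ROCP objective `f(X) = (1/2) ∑_{i,j} ∑_{k,l} μ_i x_{ik} μ_j x_{jl} |k - l|`. -/
noncomputable def fROCP {n q : ℕ} (μ : Fin n → ℝ) (X : Matrix (Fin n) (Fin q) ℝ) : ℝ :=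
  (1 / 2) * ∑ i, ∑ j, ∑ k, ∑ l,
    μ i * X i k * (μ j * X j l) * |((k : ℕ) : ℝ) - ((l : ℕ) : ℝ)|

/-- The feasible set of the relaxed optimal caterpillar problem (ROCP): box constraints,
unique assignment of each vertex, one internal vertex per backbone position, and balance
of vertex degrees (positions `k = 1, ..., q` are represented by `Fin q`, vertex indices
`i = 1, ..., n` by `Fin n`, internal indices being those with `(i : ℕ) < q`). -/
def ROCPFeasible (n q : ℕ) (d : Fin n → ℕ) (X : Matrix (Fin n) (Fin q) ℝ) : Prop :=
  (∀ i k, 0 ≤ X i k ∧ X i k ≤ 1) ∧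
  (∀ i, ∑ k, X i k = 1) ∧
  (∀ k, (∑ i : Fin n, if (i : ℕ) < q then X i k else 0) = 1) ∧
  (∀ k : Fin q, (k : ℕ) ≠ 0 → (k : ℕ) ≠ q - 1 → ∑ i, ((d i : ℝ) - 2) * X i k = 0) ∧
  (∀ k : Fin q, ((k : ℕ) = 0 ∨ (k : ℕ) = q - 1) → ∑ i, ((d i : ℝ) - 2) * X i k = -1)

/-- A matrix is a symmetric solution if `x_{ik} = x_{i, q-k+1}` for all `i`, `k`. -/
def SymmetricSol {n q : ℕ} (X : Matrix (Fin n) (Fin q) ℝ) : Prop :=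
  ∀ i k, X i k = X i k.rev

lemma fROCP_eq_weights {n q : ℕ} (μ : Fin n → ℝ) (X : Matrix (Fin n) (Fin q) ℝ) :
    fROCP μ X = (1 / 2) * ∑ k : Fin q, ∑ l : Fin q,
      (∑ i, μ i * X i k) * (∑ j, μ j * X j l) * |((k : ℕ) : ℝ) - ((l : ℕ) : ℝ)| := by
  unfold fROCP
  congr 1
  have h1 : ∀ k l : Fin q,
      (∑ i, μ i * X i k) * (∑ j, μ j * X j l) * |((k : ℕ) : ℝ) - ((l : ℕ) : ℝ)|
      = ∑ i, ∑ j, μ i * X i k * (μ j * X j l) * |((k : ℕ) : ℝ) - ((l : ℕ) : ℝ)| := by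
    intro k l
    rw [Finset.sum_mul_sum, Finset.sum_mul]
    exact Finset.sum_congr rfl fun i _ => Finset.sum_mul _ _ _
  simp_rw [h1]
  calc _ = ∑ i, ∑ k, ∑ j, ∑ l,
        μ i * X i k * (μ j * X j l) * |((k : ℕ) : ℝ) - ((l : ℕ) : ℝ)| :=
        Finset.sum_congr rfl fun i _ => Finset.sum_comm
    _ = ∑ k, ∑ i, ∑ l, ∑ j,
        μ i * X i k * (μ j * X j l) * |((k : ℕ) : ℝ) - ((l : ℕ) : ℝ)| := by
        rw [Finset.sum_comm]
        exact Finset.sum_congr rfl fun k _ => Finset.sum_congr rfl fun i _ => Finset.sum_comm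
    _ = _ := Finset.sum_congr rfl fun k _ => Finset.sum_comm

/-- difference of two indicator functions -/
noncomputable def dind {m : ℕ} (a b : Fin m) (k : Fin m) : ℝ :=
  (if k = a then 1 else 0) - (if k = b then 1 else 0)

lemma sum_mul_dind {m : ℕ} (a b : Fin m) (g : Fin m → ℝ) :
    ∑ k, g k * dind a b k = g a - g b := by
  simp [dind, mul_sub, Finset.sum_sub_distrib]

lemma quad_change {q : ℕ} (W : Fin q → ℝ) (a b : Fin q) (δ : ℝ) (A : Fin q → Fin q → ℝ)
    (hA : ∀ k l, A k l = A l k) :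
    ∑ k, ∑ l, (W k + δ * dind a b k) * (W l + δ * dind a b l) * A k l
      = ∑ k, ∑ l, W k * W l * A k l + 2 * δ * ∑ l, W l * (A a l - A b l)
        + δ ^ 2 * (A a a - 2 * A a b + A b b) := by
  have h1 : ∀ k, ∑ l, (W k + δ * dind a b k) * (W l + δ * dind a b l) * A k l
      = ∑ l, W k * W l * A k l + δ * (W k * (A k a - A k b))
        + (δ * (∑ l, W l * A k l) + δ ^ 2 * (A k a - A k b)) * dind a b k := by
    intro k
    rw [← sum_mul_dind a b (A k)]
    simp only [Finset.mul_sum, Finset.sum_mul, ← Finset.sum_add_distrib, add_mul]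
    exact Finset.sum_congr rfl fun l _ => by ring
  simp_rw [h1]
  rw [Finset.sum_add_distrib, Finset.sum_add_distrib, sum_mul_dind, ← Finset.mul_sum]
  have h2 : ∑ k, W k * (A k a - A k b) = ∑ l, W l * (A a l - A b l) :=
    Finset.sum_congr rfl fun l _ => by rw [hA l a, hA l b]
  have h3 : ∑ l, W l * (A a l - A b l) = ∑ l, W l * A a l - ∑ l, W l * A b l := by
    rw [← Finset.sum_sub_distrib]
    exact Finset.sum_congr rfl fun l _ => by ring
  rw [h2, hA b a]
  rw [h3]
  ring

lemma slope_bound {q : ℕ} (W : Fin q → ℝ) (hW : ∀ l, 0 ≤ W l) (hs : ∀ l, W l = W l.rev)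
    (a b : Fin q) (hab : (b : ℕ) = a + 1) (hb : 2 * (b : ℕ) + 1 ≤ q) :
    W b ≤ ∑ l : Fin q, W l * (|((a : ℕ) : ℝ) - ((l : ℕ) : ℝ)| - |((b : ℕ) : ℝ) - ((l : ℕ) : ℝ)|) := by
  set s : Fin q → ℝ := fun l => |((a : ℕ) : ℝ) - ((l : ℕ) : ℝ)| - |((b : ℕ) : ℝ) - ((l : ℕ) : ℝ)|
    with hsdef
  have hs1 : ∀ l : Fin q, (b : ℕ) ≤ l → s l = 1 := by
    intro l hl
    have h1 : ((b : ℕ) : ℝ) ≤ ((l : ℕ) : ℝ) := by exact_mod_cast hl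
    have h2 : ((b : ℕ) : ℝ) = ((a : ℕ) : ℝ) + 1 := by exact_mod_cast hab
    simp only [hsdef]
    rw [abs_of_nonpos (by linarith), abs_of_nonpos (by linarith)]
    linarith
  have hs2 : ∀ l : Fin q, (l : ℕ) < b → s l = -1 := by
    intro l hl
    have h1 : ((l : ℕ) : ℝ) ≤ ((a : ℕ) : ℝ) := by
      have : (l : ℕ) ≤ a := by omega
      exact_mod_cast this
    have h2 : ((b : ℕ) : ℝ) = ((a : ℕ) : ℝ) + 1 := by exact_mod_cast hab
    simp only [hsdef]
    rw [abs_of_nonneg (by linarith), abs_of_nonneg (by linarith)]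
    linarith
  have hrev : ∑ l, W l * s l = ∑ l : Fin q, W l * s l.rev := by
    rw [← Equiv.sum_comp Fin.revPerm (fun l => W l * s l)]
    exact Finset.sum_congr rfl fun l _ => by
      simp only [Fin.revPerm_apply]
      rw [← hs l]
  have hnn : ∀ l : Fin q, 0 ≤ W l * (s l + s l.rev) := by
    intro l
    apply mul_nonneg (hW l)
    have hr := Fin.val_rev l
    rcases Nat.lt_or_ge l b with h | h
    · rw [hs2 l h, hs1 l.rev (by omega)]
      norm_num
    · rw [hs1 l h]
      rcases Nat.lt_or_ge l.rev b with h' | h'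
      · rw [hs2 _ h']
        norm_num
      · rw [hs1 _ h']
        norm_num
  have hsum : W b * (s b + s b.rev) ≤ ∑ l : Fin q, W l * (s l + s l.rev) :=
    Finset.single_le_sum (f := fun l : Fin q => W l * (s l + s l.rev)) (fun l _ => hnn l) (Finset.mem_univ b)
  have hr := Fin.val_rev b
  rw [hs1 b le_rfl, hs1 b.rev (by omega)] at hsum
  simp_rw [mul_add, Finset.sum_add_distrib] at hsum
  rw [← hrev] at hsum
  linarith

theorem pendent_ordering_in_optimal_symmetric_solution (n q : ℕ) (hnq : q ≤ n) (hq : 4 ≤ q)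
    (d : Fin n → ℕ) (μ : Fin n → ℝ)
    (hμ : ∀ i, 0 ≤ μ i)
    (hμ_inj : Function.Injective μ)
    (hμ_pend : ∀ i j : Fin n, q ≤ (i : ℕ) → i < j → μ j < μ i)
    (hd_anti : ∀ i j : Fin n, i ≤ j → d j ≤ d i)
    (hd_sum : ∑ i, d i = 2 * (n - 1))
    (hd_int : ∀ i : Fin n, (i : ℕ) < q → 1 < d i)
    (hd_pend : ∀ i : Fin n, q ≤ (i : ℕ) → d i = 1)
    (X : Matrix (Fin n) (Fin q) ℝ)
    (hfeas : ROCPFeasible n q d X)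
    (hopt : ∀ Y, ROCPFeasible n q d Y → fROCP μ Y ≤ fROCP μ X)
    (hsym : SymmetricSol X)
    (i j : Fin n) (hi : q ≤ (i : ℕ)) (hj : q ≤ (j : ℕ))
    (k : ℕ) (hk2 : 2 ≤ k) (hkc : k ≤ (q + 1) / 2)
    (hxi : 0 < X i ⟨k - 2, by omega⟩) (hxj : 0 < X j ⟨k - 1, by omega⟩) :
    i ≤ j := by
  by_contra hij
  have hji : j < i := not_le.mp hij
  have hμij := hμ_pend j i hj hji
  obtain ⟨hbox, hrow, hcol, hmid, hend⟩ := hfeas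
  set a : Fin q := ⟨k - 2, by omega⟩ with ha
  set b : Fin q := ⟨k - 1, by omega⟩ with hb
  have hab : (b : ℕ) = a + 1 := by simp [ha, hb]; omega
  have hb2 : 2 * (b : ℕ) + 1 ≤ q := by simp [hb]; omega
  have hne : a ≠ b := by
    intro h
    rw [h] at hab
    omega
  obtain ⟨ε, hε0, hεi, hεj⟩ : ∃ ε : ℝ, 0 < ε ∧ ε ≤ X i a ∧ 2 * ε ≤ X j b :=
    ⟨min (X i a) (X j b / 2), lt_min hxi (by linarith), min_le_left _ _, by
      have := min_le_right (X i a) (X j b / 2)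
      linarith⟩
  set Y : Matrix (Fin n) (Fin q) ℝ := fun r l => X r l + ε * dind j i r * dind a b l with hY
  have hsum0 : ∑ l, dind a b l = 0 := by
    have := sum_mul_dind a b (fun _ => 1)
    simpa using this
  have hYrow : ∀ r, ∑ l, Y r l = 1 := by
    intro r
    simp only [hY, Finset.sum_add_distrib, ← Finset.mul_sum, hsum0, hrow r]
    ring
  have hYnn : ∀ r l, 0 ≤ Y r l := by
    intro r l
    have h0 := (hbox r l).1
    simp only [hY, dind]
    have hnij : j ≠ i := ne_of_lt hji
    by_cases h1 : r = j
    · subst h1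
      by_cases h2 : l = a
      · subst h2
        simp only [if_true, if_neg hnij, if_neg hne]
        linarith
      · by_cases h3 : l = b
        · subst h3
          simp only [if_true, if_neg hnij, if_neg h2]
          linarith
        · simp only [if_neg h2, if_neg h3]
          linarith
    · by_cases h4 : r = i
      · subst h4
        by_cases h2 : l = a
        · subst h2
          simp only [if_true, if_neg h1, if_neg hne]
          linarith
        · by_cases h3 : l = b
          · subst h3
            simp only [if_true, if_neg h1, if_neg h2]
            linarith
          · simp only [if_neg h2, if_neg h3]
            linarith
      · simp only [if_neg h1, if_neg h4]
        linarith
  have hYlin : ∀ (g : Fin n → ℝ) (l : Fin q),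
      ∑ r, g r * Y r l = ∑ r, g r * X r l + ε * (g j - g i) * dind a b l := by
    intro g l
    rw [← sum_mul_dind j i g]
    simp only [hY, Finset.mul_sum, Finset.sum_mul, ← Finset.sum_add_distrib]
    exact Finset.sum_congr rfl fun r _ => by ring
  have hYd : ∀ l, ∑ r, ((d r : ℝ) - 2) * Y r l = ∑ r, ((d r : ℝ) - 2) * X r l := by
    intro l
    rw [hYlin (fun r => (d r : ℝ) - 2) l, hd_pend i hi, hd_pend j hj]
    ring
  have hYfeas : ROCPFeasible n q d Y := by
    refine ⟨fun r l => ⟨hYnn r l, ?_⟩, hYrow, ?_, ?_, ?_⟩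
    · rw [← hYrow r]
      exact Finset.single_le_sum (f := fun l => Y r l) (fun l _ => hYnn r l) (Finset.mem_univ l)
    · intro l
      have h := hYlin (fun r => if (r : ℕ) < q then 1 else 0) l
      simp only [if_neg (not_lt.mpr hi), if_neg (not_lt.mpr hj), ite_mul, one_mul, zero_mul,
        sub_self, mul_zero, add_zero] at h
      rw [h, hcol l]
    · intro l h1 h2
      rw [hYd, hmid l h1 h2]
    · intro l h1
      rw [hYd, hend l h1]
  have hle := hopt Y hYfeas
  rw [fROCP_eq_weights, fROCP_eq_weights] at hle
  simp only [hYlin μ] at hle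
  have hquad := quad_change (fun l => ∑ r, μ r * X r l) a b (ε * (μ j - μ i))
    (fun k l => |((k : ℕ) : ℝ) - ((l : ℕ) : ℝ)|) (fun k l => abs_sub_comm _ _)
  have hslope := slope_bound (fun l => ∑ r, μ r * X r l)
    (fun l => Finset.sum_nonneg fun r _ => mul_nonneg (hμ r) (hbox r l).1)
    (fun l => Finset.sum_congr rfl fun r _ => by rw [hsym r l]) a b hab hb2
  beta_reduce at hquad hslope
  rw [hquad] at hle
  have hWb : μ j * X j b ≤ ∑ r, μ r * X r b :=
    Finset.single_le_sum (f := fun r => μ r * X r b)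
      (fun r _ => mul_nonneg (hμ r) (hbox r b).1) (Finset.mem_univ j)
  have habR : ((b : ℕ) : ℝ) = ((a : ℕ) : ℝ) + 1 := by exact_mod_cast hab
  have hA : |((a : ℕ) : ℝ) - ((b : ℕ) : ℝ)| = 1 := by
    rw [habR]
    simp
  rw [hA, sub_self, sub_self, abs_zero] at hle
  set D := ∑ l : Fin q, (∑ r, μ r * X r l) *
    (|((a : ℕ) : ℝ) - ((l : ℕ) : ℝ)| - |((b : ℕ) : ℝ) - ((l : ℕ) : ℝ)|) with hD
  have hδ : 0 < ε * (μ j - μ i) := mul_pos hε0 (by linarith)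
  have hμi := hμ i
  have hlt : ε * (μ j - μ i) < D := by
    have h1 : ε * (μ j - μ i) ≤ ε * μ j := mul_le_mul_of_nonneg_left (by linarith) hε0.le
    have h2 : 0 < ε * μ j := mul_pos hε0 (by linarith)
    have h3 : μ j * (2 * ε) ≤ μ j * X j b := mul_le_mul_of_nonneg_left hεj (hμ j)
    linarith
  have := mul_pos hδ (sub_pos.mpr hlt)
  linarith
end

section
/- Let the weights μ_1, ..., μ_n ≥ 0 be monotone in the degrees d (equal weights allowed). Then there exists an optimal symmetric solution X of ROCP such that whenever x_{ik} > 0 for some internal index i ∈ {1, ..., q} and some position k ≤ ⌈q/2⌉, then x_{jl} = 0 for all j = 1, ..., i and all l = k+1, ..., ⌈q/2⌉. -/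
open Matrix Finset

/-- Greedy filling level of the item of rank `r` when the total amount is `t`. -/
noncomputable def greedyFill (t : ℝ) (r : ℕ) : ℝ := max 0 (min (1 / 2) (t - r / 2))

lemma greedyFill_nonneg (t : ℝ) (r : ℕ) : 0 ≤ greedyFill t r := le_max_left _ _

lemma greedyFill_le (t : ℝ) (r : ℕ) : greedyFill t r ≤ 1 / 2 :=
  max_le (by norm_num) (min_le_left _ _)

lemma greedyFill_mono {s t : ℝ} (h : s ≤ t) (r : ℕ) : greedyFill s r ≤ greedyFill t r := by
  unfold greedyFill
  gcongr

lemma greedyFill_eq_half {t : ℝ} {r : ℕ} (h : (r : ℝ) + 1 ≤ 2 * t) : greedyFill t r = 1 / 2 := by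
  unfold greedyFill
  rw [min_eq_left (by linarith), max_eq_right (by norm_num)]

lemma greedyFill_eq_zero {t : ℝ} {r : ℕ} (h : 2 * t ≤ r) : greedyFill t r = 0 := by
  unfold greedyFill
  apply max_eq_left
  exact (min_le_right _ _).trans (by linarith)

lemma sum_greedyFill (N : ℕ) {t : ℝ} (ht : 0 ≤ t) :
    ∑ r : Fin N, greedyFill t r = min t (N / 2) := by
  rw [Fin.sum_univ_eq_sum_range (fun r => greedyFill t r)]
  induction N with
  | zero => simp [ht]
  | succ N ih =>
    rw [sum_range_succ, ih]
    unfold greedyFill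
    push_cast
    rcases le_total t (N / 2) with h | h
    · rw [min_eq_left h, min_eq_left (show t ≤ ((N : ℝ) + 1) / 2 by linarith), max_eq_left]
      · ring
      · exact (min_le_right _ _).trans (by linarith)
    · rw [min_eq_right h]
      rcases le_total t ((N + 1) / 2) with h2 | h2
      · rw [min_eq_left h2, min_eq_right (by linarith), max_eq_right (by linarith)]; ring
      · rw [min_eq_right h2, min_eq_left (by linarith), max_eq_right (by norm_num)]; ring

lemma greedy_dominates {N : ℕ} (c : Fin N → ℝ) (hc : Antitone c) (hc0 : ∀ i, 0 ≤ c i)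
    (y : Fin N → ℝ) (hy0 : ∀ i, 0 ≤ y i) (hy1 : ∀ i, y i ≤ 1 / 2) {t : ℝ} 
    (hyt : ∑ i, y i ≤ t) :
    ∑ i, c i * y i ≤ ∑ i, c i * greedyFill t i := by
  have ht : 0 ≤ t := (sum_nonneg fun i _ => hy0 i).trans hyt
  rcases le_or_gt ((N : ℝ) / 2) t with h | h
  · apply sum_le_sum
    intro i _
    have : ((i : ℕ) : ℝ) + 1 ≤ N := by exact_mod_cast i.2
    rw [greedyFill_eq_half (by linarith)]
    exact mul_le_mul_of_nonneg_left (hy1 i) (hc0 i)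
  · have hr : ⌊2 * t⌋₊ < N := by
      rw [Nat.floor_lt (by linarith)]; linarith
    set r0 : Fin N := ⟨⌊2 * t⌋₊, hr⟩ with hr0
    have hS := sum_greedyFill N ht
    rw [min_eq_left h.le] at hS
    have key : 0 ≤ ∑ i, (c i - c r0) * (greedyFill t i - y i) := by
      apply sum_nonneg
      intro i _
      rcases lt_trichotomy i r0 with hi | hi | hi
      · have h1 : (i : ℕ) + 1 ≤ ⌊2 * t⌋₊ := hi
        have h2 : ((i : ℕ) : ℝ) + 1 ≤ 2 * t := by
          have := (Nat.le_floor_iff (by linarith)).1 h1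
          exact_mod_cast this
        rw [greedyFill_eq_half h2]
        exact mul_nonneg (sub_nonneg.2 (hc hi.le)) (sub_nonneg.2 (hy1 i))
      · rw [hi]; simp
      · have h1 : ⌊2 * t⌋₊ < (i : ℕ) := hi
        have h2 := (Nat.floor_lt (by linarith)).1 h1
        rw [greedyFill_eq_zero h2.le]
        exact mul_nonneg_of_nonpos_of_nonpos (sub_nonpos.2 (hc hi.le)) (by linarith [hy0 i])
    have e : ∑ i, (c i - c r0) * (greedyFill t i - y i)
        = ∑ i, c i * greedyFill t i - ∑ i, c i * y i
          - c r0 * (∑ i : Fin N, greedyFill t i - ∑ i, y i) := by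
      rw [← sum_sub_distrib, ← sum_sub_distrib, mul_sum, ← sum_sub_distrib]
      exact sum_congr rfl fun i _ => by ring
    rw [e, hS] at key
    have := mul_nonneg (hc0 r0) (sub_nonneg.2 hyt)
    linarith

/-- Cumulative row sums. -/
noncomputable def cumRow {n q : ℕ} (X : Matrix (Fin n) (Fin q) ℝ) (i : Fin n) (t : ℕ) : ℝ :=
  ∑ k : Fin q, if (k : ℕ) < t then X i k else 0

lemma sum_ind (k m : ℕ) (h : k ≤ m) :
    ∑ t ∈ range (m + 1), (if k < t then (1 : ℝ) else 0) = m - k := by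
  induction m, h using Nat.le_induction with
  | base =>
    rw [sub_self]
    apply sum_eq_zero
    intro t ht
    rw [mem_range] at ht
    rw [if_neg (by omega)]
  | succ m hm ih =>
    rw [sum_range_succ, ih, if_pos (by omega)]
    push_cast; ring

lemma abs_eq_sum_ind (k l m : ℕ) (hk : k ≤ m) (hl : l ≤ m) :
    |(k : ℝ) - l| = ∑ t ∈ range (m + 1),
      ((if k < t then (1 : ℝ) else 0) - (if l < t then (1 : ℝ) else 0)) ^ 2 := by
  wlog h : k ≤ l generalizing k l
  · rw [abs_sub_comm, this l k hl hk (by omega)]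
    exact sum_congr rfl fun t _ => by ring
  · have : ∀ t ∈ range (m + 1),
      ((if k < t then (1 : ℝ) else 0) - (if l < t then (1 : ℝ) else 0)) ^ 2
        = (if k < t then (1 : ℝ) else 0) - (if l < t then (1 : ℝ) else 0) := by
      intro t _
      by_cases h1 : k < t <;> by_cases h2 : l < t <;> simp [h1, h2]
      omega
    rw [sum_congr rfl this, sum_sub_distrib, sum_ind k m hk, sum_ind l m hl, abs_sub_comm,
      abs_of_nonneg]
    · ring
    · rw [sub_nonneg]; exact_mod_cast h

lemma fROCP_eq {n q : ℕ} (μ : Fin n → ℝ) (X : Matrix (Fin n) (Fin q) ℝ)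
    (hX : ∀ i, ∑ k, X i k = 1) :
    fROCP μ X = ∑ t ∈ range (q + 1),
      (∑ i, μ i * cumRow X i t) * (∑ i, μ i - ∑ i, μ i * cumRow X i t) := by
  set w : Fin q → ℝ := fun k => ∑ i, μ i * X i k with hw
  have hM : ∑ i, μ i = ∑ k, w k := by
    rw [hw, sum_comm]
    exact sum_congr rfl fun i _ => by rw [← mul_sum, hX, mul_one]
  have hW : ∀ t, ∑ i, μ i * cumRow X i t = ∑ k, w k * (if (k : ℕ) < t then 1 else 0) := by
    intro t
    simp only [cumRow, mul_sum, hw, sum_mul]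
    rw [sum_comm]
    refine sum_congr rfl fun k _ => sum_congr rfl fun i _ => ?_
    split_ifs <;> ring
  have h1 : fROCP μ X = (1 / 2) * ∑ k, ∑ l, w k * w l * |((k : ℕ) : ℝ) - ((l : ℕ) : ℝ)| := by
    unfold fROCP
    congr 1
    calc _ = ∑ i, ∑ k, ∑ j, ∑ l, μ i * X i k * (μ j * X j l) * |((k : ℕ) : ℝ) - ((l : ℕ) : ℝ)| :=
          sum_congr rfl fun i _ => sum_comm
      _ = ∑ k, ∑ i, ∑ j, ∑ l, μ i * X i k * (μ j * X j l) * |((k : ℕ) : ℝ) - ((l : ℕ) : ℝ)| :=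
          sum_comm
      _ = ∑ k, ∑ i, ∑ l, ∑ j, μ i * X i k * (μ j * X j l) * |((k : ℕ) : ℝ) - ((l : ℕ) : ℝ)| :=
          sum_congr rfl fun k _ => sum_congr rfl fun i _ => sum_comm
      _ = ∑ k, ∑ l, ∑ i, ∑ j, μ i * X i k * (μ j * X j l) * |((k : ℕ) : ℝ) - ((l : ℕ) : ℝ)| :=
          sum_congr rfl fun k _ => sum_comm
      _ = _ := by
          refine sum_congr rfl fun k _ => sum_congr rfl fun l _ => ?_
          simp only [hw]
          rw [sum_mul_sum, sum_mul]
          exact sum_congr rfl fun i _ => by rw [sum_mul]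
  rw [h1, hM]
  have h2 : ∀ k l : Fin q, w k * w l * |((k : ℕ) : ℝ) - ((l : ℕ) : ℝ)|
      = ∑ t ∈ range (q + 1), w k * w l * 
      ((if (k : ℕ) < t then (1 : ℝ) else 0) - (if (l : ℕ) < t then (1 : ℝ) else 0)) ^ 2 := by
    intro k l
    rw [abs_eq_sum_ind k l q k.2.le l.2.le, mul_sum]
  simp_rw [h2]
  have h3 : ∑ k, ∑ l, ∑ t ∈ range (q + 1), w k * w l * 
      ((if (k : ℕ) < t then (1 : ℝ) else 0) - (if (l : ℕ) < t then (1 : ℝ) else 0)) ^ 2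
      = ∑ t ∈ range (q + 1), ∑ k, ∑ l, w k * w l * 
      ((if (k : ℕ) < t then (1 : ℝ) else 0) - (if (l : ℕ) < t then (1 : ℝ) else 0)) ^ 2 := by
    rw [sum_comm]
    rw [sum_congr rfl fun k _ => sum_comm]
    rw [sum_comm]
    exact sum_congr rfl fun t _ => sum_comm
  rw [h3, mul_sum]
  refine sum_congr rfl fun t _ => ?_
  rw [hW]
  have h4 : ∑ k, ∑ l, w k * w l * 
      ((if (k : ℕ) < t then (1 : ℝ) else 0) - (if (l : ℕ) < t then (1 : ℝ) else 0)) ^ 2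
      = ∑ k, ∑ l, ((w k * (if (k : ℕ) < t then (1 : ℝ) else 0)) * w l
        + w k * (w l * (if (l : ℕ) < t then (1 : ℝ) else 0))
        - 2 * ((w k * (if (k : ℕ) < t then (1 : ℝ) else 0))
          * (w l * (if (l : ℕ) < t then (1 : ℝ) else 0)))) := by
    refine sum_congr rfl fun k _ => sum_congr rfl fun l _ => ?_
    split_ifs <;> ring
  rw [h4]
  simp only [sum_sub_distrib, sum_add_distrib, ← mul_sum, ← sum_mul]
  ring

lemma cumRow_mono {n q : ℕ} {X : Matrix (Fin n) (Fin q) ℝ} (hX : ∀ i k, 0 ≤ X i k) (i : Fin n)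
    {s t : ℕ} (h : s ≤ t) : cumRow X i s ≤ cumRow X i t := by
  apply sum_le_sum
  intro k _
  have := hX i k
  split_ifs <;> first | exact le_rfl | assumption | omega

lemma cumRow_symm {n q : ℕ} {X : Matrix (Fin n) (Fin q) ℝ} (hX : ∀ i, ∑ k, X i k = 1)
    (hs : SymmetricSol X) (i : Fin n) {t : ℕ} (h : t ≤ q) :
    cumRow X i (q - t) = 1 - cumRow X i t := by
  have : cumRow X i (q - t) = ∑ k : Fin q, if (k : ℕ) < t then 0 else X i k := by
    unfold cumRow
    rw [← Equiv.sum_comp Fin.revPerm]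
    refine sum_congr rfl fun k _ => ?_
    rw [Fin.revPerm_apply, ← hs, Fin.val_rev]
    have := k.2
    split_ifs <;> first | rfl | omega
  rw [this, ← hX i, cumRow, ← sum_sub_distrib]
  exact sum_congr rfl fun k _ => by split_ifs <;> simp

lemma optimal_of_cum {n q : ℕ} (μ : Fin n → ℝ) (hμ : ∀ i, 0 ≤ μ i)
    (X Y : Matrix (Fin n) (Fin q) ℝ) (hX : ∀ i, ∑ k, X i k = 1) (hY : ∀ i, ∑ k, Y i k = 1)
    (hX0 : ∀ i k, 0 ≤ X i k) (hs : SymmetricSol X)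
    (H : ∀ t, 2 * t ≤ q → ∑ i, μ i * ((cumRow Y i t + 1 - cumRow Y i (q - t)) / 2)
      ≤ ∑ i, μ i * cumRow X i t) :
    fROCP μ Y ≤ fROCP μ X := by
  rw [fROCP_eq μ X hX, fROCP_eq μ Y hY]
  set M := ∑ i, μ i with hM
  set V : ℕ → ℝ := fun t => ∑ i, μ i * cumRow Y i t with hV
  set W : ℕ → ℝ := fun t => ∑ i, μ i * cumRow X i t with hW
  change ∑ t ∈ range (q + 1), V t * (M - V t) ≤ ∑ t ∈ range (q + 1), W t * (M - W t)
  have hWs : ∀ t, t ≤ q → W (q - t) = M - W t := by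
    intro t ht
    simp only [hW, hM]
    rw [← sum_sub_distrib]
    exact sum_congr rfl fun i _ => by rw [cumRow_symm hX hs i ht]; ring
  have key : ∀ t, 2 * t ≤ q → V t * (M - V t) + V (q - t) * (M - V (q - t))
      ≤ W t * (M - W t) + W (q - t) * (M - W (q - t)) := by
    intro t ht
    have h1 : (V t + M - V (q - t)) / 2 ≤ W t := by
      refine le_trans (le_of_eq ?_) (H t ht)
      simp only [hV, hM]
      rw [← sum_add_distrib, ← sum_sub_distrib, sum_div]
      exact sum_congr rfl fun i _ => by ring
    have h2 : W t ≤ W (q - t) := sum_le_sum fun i _ =>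
      mul_le_mul_of_nonneg_left (cumRow_mono hX0 i (by omega)) (hμ i)
    have h3 := hWs t (by omega)
    rw [h3] at h2 ⊢
    nlinarith [sq_nonneg (V t - (M - V (q - t))),
      mul_nonneg (sub_nonneg.2 h1) (show 0 ≤ M - W t - (V t + M - V (q - t)) / 2 by linarith)]
  have key2 : ∀ t ∈ range (q + 1), V t * (M - V t) + V (q - t) * (M - V (q - t))
      ≤ W t * (M - W t) + W (q - t) * (M - W (q - t)) := by
    intro t ht
    rw [mem_range] at ht
    rcases le_or_gt (2 * t) q with h | h
    · exact key t h
    · have := key (q - t) (by omega)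
      rw [show q - (q - t) = t by omega] at this
      linarith
  have := sum_le_sum key2
  rw [sum_add_distrib, sum_add_distrib] at this
  have r1 := sum_range_reflect (fun t => V t * (M - V t)) (q + 1)
  have r2 := sum_range_reflect (fun t => W t * (M - W t)) (q + 1)
  simp only [Nat.add_sub_cancel] at r1 r2
  rw [r1, r2] at this
  linarith

lemma exists_antitone_perm {p : ℕ} (c : Fin p → ℝ) :
    ∃ σ : Equiv.Perm (Fin p), Antitone (fun r => c (σ r)) := by
  refine ⟨Tuple.sort (fun j => - c j), fun a b hab => ?_⟩
  have := Tuple.monotone_sort (fun j => - c j) hab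
  simpa using this

lemma sum_fin_lt {q t : ℕ} (h : ℕ → ℝ) (ht : t ≤ q) :
    (∑ k : Fin q, if (k : ℕ) < t then h k else 0) = ∑ k ∈ range t, h k := by
  rw [Fin.sum_univ_eq_sum_range (fun k => if k < t then h k else 0), ← sum_filter]
  congr 1
  ext k
  simp only [mem_filter, mem_range]
  omega

lemma sum_ite_internal {q p : ℕ} (f : Fin (q + p) → ℝ) :
    (∑ i : Fin (q + p), if (i : ℕ) < q then f i else 0) = ∑ i : Fin q, f (Fin.castAdd p i) := by
  rw [Fin.sum_univ_add]
  simp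

theorem exists_internal_exclusion_optimal_symmetric_solution (n q : ℕ)
    (hnq : q ≤ n) (hq : 4 ≤ q)
    (d : Fin n → ℕ) (μ : Fin n → ℝ)
    (hμ : ∀ i, 0 ≤ μ i)
    (hμ_mono : ∀ i j : Fin n, 2 ≤ d i → 2 ≤ d j → i < j → μ j ≤ μ i)
    (hd_anti : ∀ i j : Fin n, i ≤ j → d j ≤ d i)
    (hd_sum : ∑ i, d i = 2 * (n - 1))
    (hd_int : ∀ i : Fin n, (i : ℕ) < q → 1 < d i)
    (hd_pend : ∀ i : Fin n, q ≤ (i : ℕ) → d i = 1) :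
    ∃ X : Matrix (Fin n) (Fin q) ℝ,
      ROCPFeasible n q d X ∧
      (∀ Y, ROCPFeasible n q d Y → fROCP μ Y ≤ fROCP μ X) ∧
      SymmetricSol X ∧
      ∀ (i : Fin n) (_ : (i : ℕ) < q) (k : ℕ) (_ : 1 ≤ k) (hkc : k ≤ (q + 1) / 2)
        (_ : 0 < X i ⟨k - 1, by omega⟩)
        (j : Fin n) (_ : j ≤ i) (l : ℕ) (_ : k + 1 ≤ l) (hl2 : l ≤ (q + 1) / 2),
        X j ⟨l - 1, by omega⟩ = 0 := by
  obtain ⟨p, rfl⟩ := Nat.exists_eq_add_of_le hnq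
  obtain ⟨σ, hσ⟩ := exists_antitone_perm (fun j : Fin p => μ (Fin.natAdd q j))
  have hdp : ∀ j : Fin p, d (Fin.natAdd q j) = 1 := fun j => hd_pend _ (by simp)
  have hdi : ∀ i : Fin q, 2 ≤ d (Fin.castAdd p i) := fun i => hd_int _ (by simp)
  set δ : Fin q → ℝ := fun i => (d (Fin.castAdd p i) : ℝ) - 2 with hδ
  have hδ0 : ∀ i, 0 ≤ δ i := fun i => by
    have : (2 : ℝ) ≤ d (Fin.castAdd p i) := by exact_mod_cast hdi i
    simp only [hδ]; linarith
  have hδa : Antitone δ := fun i j hij => by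
    have : (d (Fin.castAdd p j) : ℝ) ≤ d (Fin.castAdd p i) := by
      exact_mod_cast hd_anti _ _ (show (i : ℕ) ≤ j from hij)
    simp only [hδ]; linarith
  have hμa : Antitone (fun i : Fin q => μ (Fin.castAdd p i)) := fun i j hij => by
    rcases hij.eq_or_lt with h | h
    · rw [h]
    · exact hμ_mono _ _ (hdi i) (hdi j) (show (i : ℕ) < j from h)
  have hδs : ∑ i, δ i = p - 2 := by
    rw [Fin.sum_univ_add] at hd_sum
    simp only [hdp] at hd_sum
    have h1 : ((∑ i : Fin q, d (Fin.castAdd p i) : ℕ) : ℝ) + p + 2 = 2 * (q + p) := by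
      have : ∑ i : Fin q, d (Fin.castAdd p i) + p + 2 = 2 * (q + p) := by
        simp at hd_sum
        omega
      exact_mod_cast this
    simp only [hδ, sum_sub_distrib]
    push_cast at h1
    simp
    linarith
  set S : ℕ → ℝ := fun k => ∑ i : Fin q, δ i * greedyFill k i with hS
  set E : ℕ → ℝ := fun k => if k = 0 then 0 else 1 + S k with hE
  set G : Fin (q + p) → ℕ → ℝ := fun i k =>
    Fin.addCases (motive := fun _ => ℝ) (fun i : Fin q => greedyFill k i)
      (fun j : Fin p => greedyFill (E k) (σ.symm j)) i with hG
  have hGi : ∀ i k, G (Fin.castAdd p i) k = greedyFill k i := fun i k => by simp [hG]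
  have hGp : ∀ j k, G (Fin.natAdd q j) k = greedyFill (E k) (σ.symm j) := fun i k => by simp [hG]
  have hS0 : ∀ k, 0 ≤ S k := fun k =>
    sum_nonneg fun i _ => mul_nonneg (hδ0 i) (greedyFill_nonneg _ _)
  have hSmono : ∀ k l, k ≤ l → S k ≤ S l := fun k l h =>
    sum_le_sum fun i _ => mul_le_mul_of_nonneg_left
      (greedyFill_mono (by exact_mod_cast h) _) (hδ0 i)
  have hEmono : ∀ k l, k ≤ l → E k ≤ E l := by
    intro k l h
    have h1 := hSmono k l h
    have h2 := hS0 l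
    simp only [hE]
    split_ifs <;> first | omega | linarith
  have hE0 : ∀ k, 0 ≤ E k := fun k => by
    have := hEmono 0 k (by omega)
    simpa [hE] using this
  have hShalf : ∀ k, q ≤ 2 * k → S k = (p - 2) / 2 := by
    intro k hk
    simp only [hS]
    rw [← hδs, sum_div]
    refine sum_congr rfl fun i _ => ?_
    rw [greedyFill_eq_half]
    · ring
    · have : (i : ℕ) + 1 ≤ 2 * k := by have := i.2; omega
      exact_mod_cast this
  have hEhalf : ∀ k, q ≤ 2 * k → E k = p / 2 := by
    intro k hk
    simp only [hE]
    rw [if_neg (by omega), hShalf k hk]; ring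
  have hEle : ∀ k, E k ≤ p / 2 := by
    intro k
    rw [← hEhalf (k + q) (by omega)]
    exact hEmono _ _ (by omega)
  have hG0 : ∀ i, G i 0 = 0 := by
    intro i
    induction i using Fin.addCases with
    | left i => rw [hGi]; exact greedyFill_eq_zero (by simp)
    | right j => rw [hGp]; exact greedyFill_eq_zero (by simp [hE])
  have hGhalf : ∀ i k, q ≤ 2 * k → G i k = 1 / 2 := by
    intro i k hk
    induction i using Fin.addCases with
    | left i =>
      rw [hGi]; apply greedyFill_eq_half
      have : (i : ℕ) + 1 ≤ 2 * k := by have := i.2; omega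
      exact_mod_cast this
    | right j =>
      rw [hGp, hEhalf k hk]; apply greedyFill_eq_half
      have : ((σ.symm j : ℕ) : ℝ) + 1 ≤ p := by exact_mod_cast (σ.symm j).2
      linarith
  have hGmono : ∀ i k l, k ≤ l → G i k ≤ G i l := by
    intro i k l h
    induction i using Fin.addCases with
    | left i => rw [hGi, hGi]; exact greedyFill_mono (by exact_mod_cast h) _
    | right j => rw [hGp, hGp]; exact greedyFill_mono (hEmono _ _ h) _
  have hsumI : ∀ k : ℕ, ∑ i : Fin q, G (Fin.castAdd p i) k = min (k : ℝ) (q / 2) := by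
    intro k
    simp only [hGi]
    exact sum_greedyFill q (by positivity)
  have hsumP : ∀ k : ℕ, ∑ j : Fin p, G (Fin.natAdd q j) k = E k := by
    intro k
    simp only [hGp]
    rw [Equiv.sum_comp σ.symm (fun r : Fin p => greedyFill (E k) r), sum_greedyFill p (hE0 k),
      min_eq_left (hEle k)]
  have hsumD : ∀ k : ℕ, ∑ i, ((d i : ℝ) - 2) * G i k = if k = 0 then 0 else -1 := by
    intro k
    rw [Fin.sum_univ_add]
    have h2 : ∑ j : Fin p, ((d (Fin.natAdd q j) : ℝ) - 2) * G (Fin.natAdd q j) k = - E k := by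
      rw [← hsumP k, ← sum_neg_distrib]
      refine sum_congr rfl fun j _ => ?_
      rw [hdp]; push_cast; ring
    have h1 : ∑ i : Fin q, ((d (Fin.castAdd p i) : ℝ) - 2) * G (Fin.castAdd p i) k = S k :=
      sum_congr rfl fun i _ => by rw [hGi]
    rw [h1, h2]
    by_cases hk : k = 0
    · subst hk
      have h3 : S 0 = 0 := sum_eq_zero fun i _ => by
        rw [greedyFill_eq_zero (by simp), mul_zero]
      rw [h3]
      simp [hE]
    · simp only [hE, if_neg hk]; ring
  set X : Matrix (Fin (q + p)) (Fin q) ℝ := fun i k =>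
    G i (k + 1) - G i k + (G i (q - k) - G i (q - (k + 1))) with hX
  have hX0 : ∀ i k, 0 ≤ X i k := by
    intro i k
    have h1 := hGmono i k (k + 1) (by omega)
    have h2 := hGmono i (q - (k + 1)) (q - k) (by omega)
    simp only [hX]; linarith
  have hcum : ∀ i t, t ≤ q → cumRow X i t = G i t - G i 0 + (G i q - G i (q - t)) := by
    intro i t ht
    unfold cumRow
    rw [sum_fin_lt (fun k => G i (k + 1) - G i k + (G i (q - k) - G i (q - (k + 1)))) ht,
      sum_add_distrib, sum_range_sub, sum_range_sub' (fun k => G i (q - k))]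
    simp
  have hrow : ∀ i, ∑ k, X i k = 1 := by
    intro i
    have h1 : cumRow X i q = ∑ k, X i k := sum_congr rfl fun k _ => if_pos k.2
    rw [← h1, hcum i q le_rfl, Nat.sub_self, hG0, hGhalf i q (by omega)]
    norm_num
  have hsym : SymmetricSol X := by
    intro i k
    have hk := k.2
    simp only [hX, Fin.val_rev]
    rw [show q - (k + 1) + 1 = q - (k : ℕ) by omega,
      show q - (q - ((k : ℕ) + 1)) = k + 1 by omega, show q - (q - (k : ℕ)) = k by omega]
    ring
  have hfeas : ROCPFeasible (q + p) q d X := by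
    have hdeg : ∀ k : Fin q, ∑ i, ((d i : ℝ) - 2) * X i k =
        (if (k : ℕ) + 1 = 0 then 0 else -1) - (if (k : ℕ) = 0 then 0 else -1)
        + ((if q - (k : ℕ) = 0 then 0 else -1) - (if q - ((k : ℕ) + 1) = 0 then 0 else -1)) := by
      intro k
      rw [← hsumD, ← hsumD, ← hsumD, ← hsumD, ← sum_sub_distrib, ← sum_sub_distrib,
        ← sum_add_distrib]
      exact sum_congr rfl fun i _ => by simp only [hX]; ring
    refine ⟨fun i k => ⟨hX0 i k, ?_⟩, hrow, ?_, ?_, ?_⟩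
    · rw [← hrow i]
      exact single_le_sum (f := fun k => X i k) (fun k _ => hX0 i k) (mem_univ k)
    · intro k
      rw [sum_ite_internal]
      simp only [hX, sum_add_distrib, sum_sub_distrib, hsumI]
      have hk := k.2
      have c1 : ((q - (k : ℕ) : ℕ) : ℝ) = q - k := Nat.cast_sub hk.le
      have c2 : ((q - ((k : ℕ) + 1) : ℕ) : ℝ) = q - (k + 1) := by
        rw [Nat.cast_sub hk]; push_cast; ring
      rw [c1, c2]
      push_cast
      have id1 : ∀ a : ℝ, min (q - a : ℝ) (q / 2) = min a (q / 2 : ℝ) + (q / 2 - a) := by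
        intro a
        rcases le_total a (q / 2 : ℝ) with h | h
        · rw [min_eq_left h, min_eq_right (by linarith)]; ring
        · rw [min_eq_right h, min_eq_left (by linarith)]; ring
      rw [id1, id1]; ring
    · intro k h1 h2
      have hk := k.2
      rw [hdeg, if_neg (by omega), if_neg (by omega), if_neg (by omega), if_neg (by omega)]
      ring
    · intro k h
      have hk := k.2
      rw [hdeg, if_neg (by omega)]
      rcases h with h | h
      · rw [if_pos h, if_neg (by omega), if_neg (by omega)]; ring
      · rw [if_neg (by omega), if_neg (by omega), if_pos (by omega)]; ring
  refine ⟨X, hfeas, ?_, hsym, ?_⟩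
  · intro Y hYf
    obtain ⟨hYb, hYr, hYc, hYd, hYe⟩ := hYf
    refine optimal_of_cum μ hμ X Y hrow hYr hX0 hsym fun t ht => ?_
    have hY0 : ∀ i k, 0 ≤ Y i k := fun i k => (hYb i k).1
    have hCq : ∀ i, cumRow Y i q = 1 := fun i => by
      rw [← hYr i]; exact sum_congr rfl fun k _ => if_pos k.2
    have hC0 : ∀ i, cumRow Y i 0 = 0 := fun i => by simp [cumRow]
    rcases Nat.eq_zero_or_pos t with rfl | htpos
    · have : ∀ i, cumRow X i 0 = 0 := fun i => by simp [cumRow]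
      simp [this, hC0, hCq]
    have hcX : ∀ i, cumRow X i t = G i t := by
      intro i
      rw [hcum i t (by omega), hG0, hGhalf i q (by omega), hGhalf i (q - t) (by omega)]
      ring
    simp only [hcX]
    set y : Fin (q + p) → ℝ := fun i => (cumRow Y i t + 1 - cumRow Y i (q - t)) / 2 with hy
    have hy0 : ∀ i, 0 ≤ y i := by
      intro i
      have h1 := cumRow_mono hY0 i (show 0 ≤ t by omega)
      have h2 := cumRow_mono hY0 i (show q - t ≤ q by omega)
      rw [hC0] at h1
      rw [hCq] at h2
      simp only [hy]; linarith
    have hy1 : ∀ i, y i ≤ 1 / 2 := by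
      intro i
      have h2 := cumRow_mono hY0 i (show t ≤ q - t by omega)
      simp only [hy]; linarith
    have hcI : ∀ s, s ≤ q → ∑ i : Fin q, cumRow Y (Fin.castAdd p i) s = s := by
      intro s hs
      unfold cumRow
      rw [sum_comm]
      have : ∀ k : Fin q, (∑ i : Fin q, if (k : ℕ) < s then Y (Fin.castAdd p i) k else 0)
          = if (k : ℕ) < s then 1 else 0 := by
        intro k
        have := hYc k
        rw [sum_ite_internal] at this
        split_ifs
        · exact this
        · simp
      rw [sum_congr rfl fun k _ => this k, sum_fin_lt (fun _ => (1 : ℝ)) hs]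
      simp
    have hcD : ∀ s, 1 ≤ s → s < q → ∑ i, ((d i : ℝ) - 2) * cumRow Y i s = -1 := by
      intro s hs1 hsq
      simp only [cumRow, mul_sum]
      rw [sum_comm]
      have : ∀ k : Fin q, (∑ i, ((d i : ℝ) - 2) * if (k : ℕ) < s then Y i k else 0)
          = if (k : ℕ) < s then (if (k : ℕ) = 0 then -1 else 0) else 0 := by
        intro k
        by_cases hk : (k : ℕ) < s
        · simp only [if_pos hk]
          by_cases hk0 : (k : ℕ) = 0
          · rw [if_pos hk0, hYe k (Or.inl hk0)]
          · rw [if_neg hk0, hYd k hk0 (by omega)]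
        · simp only [if_neg hk]; simp
      rw [sum_congr rfl fun k _ => this k, sum_fin_lt (fun k => if k = 0 then (-1 : ℝ) else 0) hsq.le]
      rw [sum_ite_eq' (range s) 0 (fun _ => (-1 : ℝ)), if_pos (mem_range.2 hs1)]
    have hyI : ∑ i : Fin q, y (Fin.castAdd p i) = t := by
      simp only [hy]
      rw [← sum_div, sum_sub_distrib, sum_add_distrib, hcI t (by omega), hcI (q - t) (by omega),
        Nat.cast_sub (by omega)]
      simp
      ring
    have hdtot : ∑ i, ((d i : ℝ) - 2) = -2 := by
      rw [Fin.sum_univ_add]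
      change ∑ i, δ i + _ = _
      rw [hδs]
      simp only [hdp]
      simp
      ring
    have hyD : ∑ i, ((d i : ℝ) - 2) * y i = -1 := by
      have : ∑ i, ((d i : ℝ) - 2) * y i = (∑ i, ((d i : ℝ) - 2) * cumRow Y i t
          + ∑ i, ((d i : ℝ) - 2) - ∑ i, ((d i : ℝ) - 2) * cumRow Y i (q - t)) / 2 := by
        rw [← sum_add_distrib, ← sum_sub_distrib, sum_div]
        exact sum_congr rfl fun i _ => by simp only [hy]; ring
      rw [this, hcD t (by omega) (by omega), hcD (q - t) (by omega) (by omega), hdtot]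
      norm_num
    have hyP : ∑ j : Fin p, y (Fin.natAdd q j) = 1 + ∑ i, δ i * y (Fin.castAdd p i) := by
      rw [Fin.sum_univ_add] at hyD
      have h2 : ∑ j : Fin p, ((d (Fin.natAdd q j) : ℝ) - 2) * y (Fin.natAdd q j)
          = - ∑ j : Fin p, y (Fin.natAdd q j) := by
        rw [← sum_neg_distrib]
        refine sum_congr rfl fun j _ => ?_
        rw [hdp]; push_cast; ring
      rw [h2] at hyD
      change ∑ i, δ i * y (Fin.castAdd p i) + _ = _ at hyD
      linarith
    have hyE : ∑ j : Fin p, y (Fin.natAdd q j) ≤ E t := by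
      rw [hyP]
      simp only [hE, if_neg (show t ≠ 0 by omega)]
      have := greedy_dominates δ hδa hδ0 (fun i => y (Fin.castAdd p i)) (fun i => hy0 _)
        (fun i => hy1 _) hyI.le
      simp only [hS]
      linarith
    rw [Fin.sum_univ_add, Fin.sum_univ_add]
    refine add_le_add ?_ ?_
    · simp only [hGi]
      exact greedy_dominates (fun i => μ (Fin.castAdd p i)) hμa (fun i => hμ _)
        (fun i => y (Fin.castAdd p i)) (fun i => hy0 _) (fun i => hy1 _) hyI.le
    · simp only [hGp]
      rw [← Equiv.sum_comp σ, ← Equiv.sum_comp σ (fun j => _ * greedyFill _ _)]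
      simp only [Equiv.symm_apply_apply]
      refine greedy_dominates (fun r => μ (Fin.natAdd q (σ r))) hσ (fun i => hμ _)
        (fun r => y (Fin.natAdd q (σ r))) (fun i => hy0 _) (fun i => hy1 _) ?_
      rw [Equiv.sum_comp σ (fun j => y (Fin.natAdd q j))]
      exact hyE
  · intro i hi k hk1 hkc hpos j hji l hkl hl2
    have hj : (j : ℕ) < q := lt_of_le_of_lt hji hi
    have hji' : (j : ℕ) ≤ i := hji
    obtain ⟨i', rfl⟩ : ∃ i' : Fin q, i = Fin.castAdd p i' := ⟨⟨i, hi⟩, rfl⟩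
    obtain ⟨j', rfl⟩ : ∃ j' : Fin q, j = Fin.castAdd p j' := ⟨⟨j, hj⟩, rfl⟩
    simp only [Fin.val_castAdd] at hi hj hji'
    simp only [hX, hGi] at hpos ⊢
    have half : ∀ (s : ℕ) (r : Fin q), (r : ℕ) < 2 * s → greedyFill s r = 1 / 2 := by
      intro s r h
      apply greedyFill_eq_half
      have h' : (r : ℕ) + 1 ≤ 2 * s := h
      exact_mod_cast h'
    have zero : ∀ (s : ℕ) (r : Fin q), 2 * s ≤ (r : ℕ) → greedyFill s r = 0 := by
      intro s r h
      apply greedyFill_eq_zero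
      exact_mod_cast h
    have hik : (i' : ℕ) < 2 * k := by
      by_contra hcon
      rw [zero (k - 1 + 1) i' (by omega), zero (k - 1) i' (by omega),
        half (q - (k - 1)) i' (by omega), half (q - (k - 1 + 1)) i' (by omega)] at hpos
      norm_num at hpos
    rw [half (l - 1 + 1) j' (by omega), half (l - 1) j' (by omega),
        half (q - (l - 1)) j' (by omega), half (q - (l - 1 + 1)) j' (by omega)]
    norm_num
end
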